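/- arXiv:2304.12381 — 2 statements merged into one kernel-verified Lean document; each statement's English description precedes it below -/
import Mathlib

section
/- Let G be a simple graph on vertices v_1, …, v_n whose degrees satisfy d_G(v_1) ≥ d_G(v_2) ≥ … ≥ d_G(v_n), and let d_1 = d_G(v_1). Then there exists a graph G' on the same vertex set, obtainable from G by a finite sequence of 2-switches, such that the neighborhood of v_1 in G' is exactly {v_2, v_3, …, v_{d_1+1}}. -/
open scoped Classical

/-- `TwoSwitch G H` holds when `H` is obtained from `G` by a single 2-switch: edges
`{u,v}, {w,x}` on four distinct vertices (with `{u,w}, {v,x}` non-edges) are replaced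
by the edges `{u,w}, {v,x}`. -/
def TwoSwitch {V : Type*} (G H : SimpleGraph V) : Prop :=
  ∃ u v w x : V, u ≠ v ∧ u ≠ w ∧ u ≠ x ∧ v ≠ w ∧ v ≠ x ∧ w ≠ x ∧
    G.Adj u v ∧ G.Adj w x ∧ ¬ G.Adj u w ∧ ¬ G.Adj v x ∧
    H = SimpleGraph.fromEdgeSet ((G.edgeSet \ {s(u, v), s(w, x)}) ∪ {s(u, w), s(v, x)})

namespace TwoSwitch

variable {V : Type*}

/-- Adjacency in the graph produced by a 2-switch. -/
theorem adj_switch_iff (G : SimpleGraph V) {u v w x : V} (huw : u ≠ w) (hvx : v ≠ x) (a b : V) :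
    (SimpleGraph.fromEdgeSet
      ((G.edgeSet \ {s(u, v), s(w, x)}) ∪ {s(u, w), s(v, x)})).Adj a b ↔
      (G.Adj a b ∧ s(a, b) ≠ s(u, v) ∧ s(a, b) ≠ s(w, x)) ∨
        s(a, b) = s(u, w) ∨ s(a, b) = s(v, x) := by
  simp only [SimpleGraph.fromEdgeSet_adj, Set.mem_union, Set.mem_sdiff, SimpleGraph.mem_edgeSet,
    Set.mem_insert_iff, Set.mem_singleton_iff, not_or]
  refine ⟨fun h => h.1, fun h => ⟨h, ?_⟩⟩
  rintro rfl
  rcases h with h | h | h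
  · exact G.loopless.irrefl _ h.1
  · simp only [Sym2.eq_iff] at h
    grind
  · simp only [Sym2.eq_iff] at h
    grind

variable [Fintype V]

/-- A 2-switch preserves all degrees. -/
theorem degree_eq {G H : SimpleGraph V} (h : TwoSwitch G H) (a : V) :
    H.degree a = G.degree a := by
  obtain ⟨u, v, w, x, huv, huw, hux, hvw, hvx, hwx, guv, gwx, guw, gvx, rfl⟩ := h
  have swap : ∀ {p q : V} {H : SimpleGraph V}, G.Adj a p → ¬ G.Adj a q →
      (∀ b, H.Adj a b ↔ b = q ∨ (b ≠ p ∧ G.Adj a b)) → H.degree a = G.degree a := by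
    intro p q H hp hq hH
    have hN : H.neighborFinset a = insert q ((G.neighborFinset a).erase p) := by
      ext b
      simp [hH]
    rw [← SimpleGraph.card_neighborFinset_eq_degree, hN,
      Finset.card_insert_of_notMem (by simp [hq]), Finset.card_erase_add_one (by simpa using hp),
      SimpleGraph.card_neighborFinset_eq_degree]
  have key := adj_switch_iff G huw hvx a
  simp only [ne_eq, Sym2.eq_iff] at key
  by_cases hau : a = u
  · subst hau
    exact swap guv guw fun b => by rw [key]; grind
  by_cases hav : a = v
  · subst hav
    exact swap guv.symm gvx fun b => by rw [key]; grind
  by_cases haw : a = w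
  · subst haw
    exact swap gwx (fun h => guw h.symm) fun b => by rw [key]; grind
  by_cases hax : a = x
  · subst hax
    exact swap gwx.symm (fun h => gvx h.symm) fun b => by rw [key]; grind
  have hN : ∀ b, _ ↔ G.Adj a b := fun b => (key b).trans (by grind)
  rw [← SimpleGraph.card_neighborFinset_eq_degree, ← SimpleGraph.card_neighborFinset_eq_degree]
  congr 1
  ext b
  simpa only [SimpleGraph.mem_neighborFinset] using hN b

/-- If `z` is adjacent to `i` but not to `j`, and `j` has degree at least that of `i`, then some
2-switch replaces the neighbor `i` of `z` by `j`. -/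
theorem exists_replace_neighbor {G : SimpleGraph V} {z i j : V} (hzj : z ≠ j)
    (hi : G.Adj z i) (hj : ¬ G.Adj z j) (hdeg : G.degree i ≤ G.degree j) :
    ∃ H, TwoSwitch G H ∧ ∀ b, H.Adj z b ↔ b = j ∨ (b ≠ i ∧ G.Adj z b) := by
  have hij : i ≠ j := fun h => hj (h ▸ hi)
  obtain ⟨x, hjx, hxi, hix⟩ : ∃ x, G.Adj j x ∧ x ≠ i ∧ ¬ G.Adj i x := by
    by_contra! hcon
    have hsub : (G.neighborFinset j).erase i ⊆ ((G.neighborFinset i).erase j).erase z := by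
      intro b hb
      simp only [Finset.mem_erase, SimpleGraph.mem_neighborFinset] at hb ⊢
      exact ⟨fun h => hj (h ▸ hb.2).symm, hb.2.ne', hcon b hb.2 hb.1⟩
    have hcard := Finset.card_le_card hsub
    have hz : z ∈ (G.neighborFinset i).erase j := by simp [hzj, hi.symm]
    have hz' := Finset.card_erase_add_one hz
    rw [← SimpleGraph.card_neighborFinset_eq_degree,
      ← SimpleGraph.card_neighborFinset_eq_degree] at hdeg
    simp only [Finset.card_erase_eq_ite, SimpleGraph.mem_neighborFinset, G.adj_comm j i] at *
    grind
  have hzx : z ≠ x := fun h => hj (h ▸ hjx).symm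
  refine ⟨_, ⟨z, i, j, x, hi.ne, hzj, hzx, hij, hxi.symm, hjx.ne, hi, hjx, hj, hix, rfl⟩, ?_⟩
  intro b
  have hne := hi.ne
  rw [adj_switch_iff G hzj hxi.symm]
  simp only [ne_eq, Sym2.eq_iff]
  grind

/-- 2-switches can turn the neighborhood of `z` into any set `T` of `G.degree z` other vertices
whose degrees dominate those of the vertices outside `T ∪ {z}`. -/
theorem exists_reflTransGen_neighborFinset_eq (G : SimpleGraph V) (z : V) (T : Finset V)
    (hz : z ∉ T) (hT : T.card = G.degree z)
    (hdeg : ∀ i ∉ T, i ≠ z → ∀ j ∈ T, G.degree i ≤ G.degree j) :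
    ∃ G', Relation.ReflTransGen TwoSwitch G G' ∧ G'.neighborFinset z = T := by
  induction hk : (T \ G.neighborFinset z).card using Nat.strong_induction_on generalizing G with
  | _ k ih =>
    subst hk
    by_cases heq : T ⊆ G.neighborFinset z
    · exact ⟨G, .refl, (Finset.eq_of_subset_of_card_le heq (by simp [hT])).symm⟩
    have hne : ¬ G.neighborFinset z ⊆ T := fun h =>
      heq (Finset.eq_of_subset_of_card_le h (by simp [hT])).ge
    obtain ⟨j, hjT, hj⟩ := Finset.not_subset.mp heq
    obtain ⟨i, hi, hiT⟩ := Finset.not_subset.mp hne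
    rw [SimpleGraph.mem_neighborFinset] at hi hj
    obtain ⟨H, hGH, hH⟩ := exists_replace_neighbor (ne_of_mem_of_not_mem hjT hz).symm hi hj
      (hdeg i hiT hi.ne' j hjT)
    have hlt : (T \ H.neighborFinset z).card < (T \ G.neighborFinset z).card := by
      refine Finset.card_lt_card (Finset.ssubset_iff_of_subset ?_ |>.mpr ⟨j, ?_, ?_⟩)
      · intro b
        simp only [Finset.mem_sdiff, SimpleGraph.mem_neighborFinset, hH]
        grind
      · simp [hjT, hj]
      · simp [hH]
    obtain ⟨G', hG', hN⟩ := ih _ hlt H (by rw [degree_eq hGH, hT])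
      (by simpa only [degree_eq hGH] using hdeg) rfl
    exact ⟨G', .head hGH hG', hN⟩

end TwoSwitch

/-- If `G` is a graph on vertices `v₁, …, vₙ` (indexed by `Fin n`) whose degrees are
nonincreasing, then some finite sequence of 2-switches transforms `G` into a graph `G'`
in which the neighborhood of the first vertex is exactly `{v₂, …, v_{d₁+1}}`. -/
theorem exists_two_switch_sequence_saturating_first_vertex
    {n : ℕ} (hn : 0 < n) (G : SimpleGraph (Fin n))
    (hdeg : Antitone fun i : Fin n => G.degree i) :
    ∃ G' : SimpleGraph (Fin n),
      Relation.ReflTransGen TwoSwitch G G' ∧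
      G'.neighborSet ⟨0, hn⟩ =
        {i : Fin n | 1 ≤ (i : ℕ) ∧ (i : ℕ) ≤ G.degree ⟨0, hn⟩} := by
  have hlt : G.degree ⟨0, hn⟩ < n := by
    simpa using G.degree_lt_card_verts ⟨0, hn⟩
  set d := G.degree ⟨0, hn⟩ with hd
  have hcard : (Finset.Ioc (⟨0, hn⟩ : Fin n) ⟨d, hlt⟩).card = d := by simp
  obtain ⟨G', hG', hN⟩ := TwoSwitch.exists_reflTransGen_neighborFinset_eq G ⟨0, hn⟩
    (Finset.Ioc ⟨0, hn⟩ ⟨d, hlt⟩) (by simp) hcard (by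
      intro i hi hi0 j hj
      apply hdeg
      simp only [Finset.mem_Ioc, Fin.lt_def, Fin.le_def, ne_eq, Fin.ext_iff] at *
      omega)
  refine ⟨G', hG', ?_⟩
  ext i
  have := congrArg (i ∈ ·) hN
  simpa [Fin.lt_def, Fin.le_def, Nat.one_le_iff_ne_zero, Nat.pos_iff_ne_zero] using this
end

section
/- A simple graph G is a split graph if and only if G contains no induced subgraph isomorphic to 2K_2, C_4, or C_5. -/
/-- A graph is a split graph if its vertex set can be partitioned into a set `K`
inducing a complete graph and an independent set `I`. -/
def IsSplit {V : Type*} (G : SimpleGraph V) : Prop :=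
  ∃ K I : Set V, K ∪ I = Set.univ ∧ Disjoint K I ∧ G.IsClique K ∧
    ∀ a ∈ I, ∀ b ∈ I, ¬ G.Adj a b

open Finset

theorem IsSplit.comap {V W : Type*} {G : SimpleGraph V} {H : SimpleGraph W} (hG : IsSplit G)
    (f : H ↪g G) : IsSplit H := by
  obtain ⟨K, I, hKI, hd, hK, hI⟩ := hG
  refine ⟨f ⁻¹' K, f ⁻¹' I, by rw [← Set.preimage_union, hKI, Set.preimage_univ],
    hd.preimage f, ?_, fun a ha b hb h => hI _ ha _ hb (f.map_adj_iff.2 h)⟩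
  exact fun a ha b hb hab => f.map_adj_iff.1 (hK ha hb (f.injective.ne hab))

theorem IsSplit.compl {V : Type*} {G : SimpleGraph V} (hG : IsSplit G) : IsSplit Gᶜ := by
  obtain ⟨K, I, hKI, hd, hK, hI⟩ := hG
  refine ⟨I, K, by rw [Set.union_comm, hKI], hd.symm, ?_, ?_⟩
  · exact fun a ha b hb hab => (G.compl_adj a b).2 ⟨hab, hI a ha b hb⟩
  · exact fun a ha b hb h => ((G.compl_adj a b).1 h).2 (hK ha hb h.ne)

theorem IsSplit.exists_bool {V : Type*} {G : SimpleGraph V} (hG : IsSplit G) :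
    ∃ p : V → Bool, ∀ a b, a ≠ b → (p a = true → p b = true → G.Adj a b) ∧
      (p a = false → p b = false → ¬ G.Adj a b) := by
  classical
  obtain ⟨K, I, hKI, -, hK, hI⟩ := hG
  have hmem (a : V) (ha : a ∉ K) : a ∈ I :=
    (Set.mem_union a K I |>.1 (hKI ▸ Set.mem_univ a)).resolve_left ha
  refine ⟨fun a => decide (a ∈ K), fun a b hab => ⟨fun ha hb => ?_, fun ha hb => ?_⟩⟩
  · exact hK (of_decide_eq_true ha) (of_decide_eq_true hb) hab
  · exact hI a (hmem a (of_decide_eq_false ha)) b (hmem b (of_decide_eq_false hb))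

theorem not_isSplit_cycleGraph_four : ¬ IsSplit (SimpleGraph.cycleGraph 4) := by
  intro h
  have := h.exists_bool
  revert this
  decide

theorem not_isSplit_cycleGraph_five : ¬ IsSplit (SimpleGraph.cycleGraph 5) := by
  intro h
  have := h.exists_bool
  revert this
  decide

namespace SimpleGraph

variable {V : Type*} {G : SimpleGraph V}

theorem nonempty_cycleGraph_four_embedding {a b c d : V} (hab : G.Adj a b) (hbc : G.Adj b c)
    (hcd : G.Adj c d) (hda : G.Adj d a) (hac : ¬ G.Adj a c) (hbd : ¬ G.Adj b d)
    (hac' : a ≠ c) (hbd' : b ≠ d) : Nonempty (cycleGraph 4 ↪g G) := by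
  refine ⟨⟨⟨![a, b, c, d], ?_⟩, ?_⟩⟩
  · intro i j
    fin_cases i <;> fin_cases j <;>
      simp [hab.ne, hbc.ne, hcd.ne, hda.ne, hab.ne', hbc.ne', hcd.ne', hda.ne', hac', hbd',
        hac'.symm, hbd'.symm]
  · intro i j
    change G.Adj (![a, b, c, d] i) (![a, b, c, d] j) ↔ _
    fin_cases i <;> fin_cases j <;>
      simp [cycleGraph_adj, hab, hbc, hcd, hda, hac, hbd, hab.symm, hbc.symm, hcd.symm, hda.symm,
        G.adj_comm c a, G.adj_comm d b] <;> decide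

theorem nonempty_compl_cycleGraph_four_embedding {a b c d : V} (hab : G.Adj a b)
    (hcd : G.Adj c d) (hac : ¬ G.Adj a c) (had : ¬ G.Adj a d) (hbc : ¬ G.Adj b c)
    (hbd : ¬ G.Adj b d) : Nonempty ((cycleGraph 4)ᶜ ↪g G) := by
  have hac' : a ≠ c := by rintro rfl; exact had hcd
  have had' : a ≠ d := by rintro rfl; exact hac hcd.symm
  have hbc' : b ≠ c := by rintro rfl; exact hac hab
  have hbd' : b ≠ d := by rintro rfl; exact had hab
  obtain ⟨f⟩ : Nonempty (cycleGraph 4 ↪g Gᶜ) :=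
    nonempty_cycleGraph_four_embedding (a := a) (b := c) (c := b) (d := d)
      ((G.compl_adj _ _).2 ⟨hac', hac⟩)
      ((G.compl_adj _ _).2 ⟨hbc'.symm, fun h => hbc h.symm⟩)
      ((G.compl_adj _ _).2 ⟨hbd', hbd⟩)
      ((G.compl_adj _ _).2 ⟨had'.symm, fun h => had h.symm⟩)
      (by simp [hab]) (by simp [hcd]) hab.ne hcd.ne
  refine ⟨⟨f.toEmbedding, fun {i j} => ?_⟩⟩
  have h := f.map_adj_iff (v := i) (w := j)
  have hf := f.injective.ne_iff (x := i) (y := j)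
  simp only [compl_adj] at h ⊢
  change G.Adj (f i) (f j) ↔ _
  have := G.ne_of_adj (a := f i) (b := f j)
  tauto

theorem nonempty_cycleGraph_five_embedding {a b c d e : V} (hab : G.Adj a b) (hbc : G.Adj b c)
    (hcd : G.Adj c d) (hde : G.Adj d e) (hea : G.Adj e a) (hac : ¬ G.Adj a c)
    (hbd : ¬ G.Adj b d) (hce : ¬ G.Adj c e) (hda : ¬ G.Adj d a) (heb : ¬ G.Adj e b) :
    Nonempty (cycleGraph 5 ↪g G) := by
  have hac' : a ≠ c := by rintro rfl; exact hda hcd.symm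
  have hbd' : b ≠ d := by rintro rfl; exact hda hab.symm
  have hce' : c ≠ e := by rintro rfl; exact hac hea.symm
  have hda' : d ≠ a := by rintro rfl; exact hac hcd.symm
  have heb' : e ≠ b := by rintro rfl; exact hbd hde.symm
  refine ⟨⟨⟨![a, b, c, d, e], ?_⟩, ?_⟩⟩
  · intro i j
    fin_cases i <;> fin_cases j <;>
      simp [hab.ne, hbc.ne, hcd.ne, hde.ne, hea.ne, hab.ne', hbc.ne', hcd.ne', hde.ne', hea.ne',
        hac', hbd', hce', hda', heb', hac'.symm, hbd'.symm, hce'.symm, hda'.symm, heb'.symm]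
  · intro i j
    change G.Adj (![a, b, c, d, e] i) (![a, b, c, d, e] j) ↔ _
    fin_cases i <;> fin_cases j <;>
      simp [cycleGraph_adj, hab, hbc, hcd, hde, hea, hac, hbd, hce, hda, heb, hab.symm, hbc.symm, hcd.symm,
        hde.symm, hea.symm, G.adj_comm c a, G.adj_comm d b, G.adj_comm e c, G.adj_comm a d,
        G.adj_comm b e] <;> decide

/-- A clique maximizing `∑ v ∈ K, (card V + deg v)` is a maximal clique, admits no exchange of one
vertex for two, and admits no exchange of a vertex for one of larger degree. -/
theorem exists_isClique_forall_exchange [Fintype V] [DecidableEq V] [DecidableRel G.Adj] :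
    ∃ K : Finset V, G.IsClique (K : Set V) ∧
      (∀ x ∉ K, ∃ u ∈ K, ¬ G.Adj x u) ∧
      (∀ x ∉ K, ∀ y ∉ K, G.Adj x y → ∀ z ∈ K,
        ∃ u ∈ K, u ≠ z ∧ ¬ (G.Adj x u ∧ G.Adj y u)) ∧
      (∀ x ∉ K, ∀ z ∈ K, (∀ u ∈ K, u ≠ z → G.Adj x u) → G.degree x ≤ G.degree z) := by
  let w (v : V) : ℕ := Fintype.card V + G.degree v
  obtain ⟨K, hK, hmax⟩ := Set.exists_max_image {K : Finset V | G.IsClique (K : Set V)}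
    (fun K => ∑ v ∈ K, w v) (Set.toFinite _) ⟨∅, by simp⟩
  simp only [Set.mem_ofPred_eq] at hK hmax
  have hpos (x : V) : 0 < Fintype.card V := Fintype.card_pos_iff.2 ⟨x⟩
  have hsub (z : V) : G.IsClique (K.erase z : Finset V) := hK.subset (by simp)
  refine ⟨K, hK, fun x hx => ?_, fun x hx y hy hxy z hz => ?_, fun x hx z hz h => ?_⟩
  · by_contra! h
    have := hmax (insert x K) (by
      rw [coe_insert]
      exact hK.insert fun u hu _ => h u hu)
    rw [sum_insert hx] at this
    have := hpos x
    simp only [w] at *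
    omega
  · by_contra! h
    have hy' : y ∉ K.erase z := fun h => hy (mem_of_mem_erase h)
    have hx' : x ∉ insert y (K.erase z) := by
      simp [hxy.ne, hx]
    have := hmax (insert x (insert y (K.erase z))) (by
      rw [coe_insert, coe_insert]
      refine ((hsub z).insert fun u hu _ => ?_).insert fun u hu _ => ?_
      · have := mem_erase.1 (mem_coe.1 hu)
        exact (h u this.2 this.1).2
      · rcases hu with rfl | hu
        · exact hxy
        · have := mem_erase.1 (mem_coe.1 hu)
          exact (h u this.2 this.1).1)
    rw [sum_insert hx', sum_insert hy', ← add_sum_erase K w hz] at this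
    have := G.degree_lt_card_verts z
    simp only [w] at *
    omega
  · have hx' : x ∉ K.erase z := fun h => hx (mem_of_mem_erase h)
    have := hmax (insert x (K.erase z)) (by
      rw [coe_insert]
      refine (hsub z).insert fun u hu _ => ?_
      have := mem_erase.1 (mem_coe.1 hu)
      exact h u this.2 this.1)
    rw [sum_insert hx', ← add_sum_erase K w hz] at this
    simp only [w] at *
    omega

theorem exists_adj_not_adj_of_degree_le [Fintype V] [DecidableRel G.Adj] {x y z : V}
    (h : G.degree x ≤ G.degree z) (hxy : G.Adj x y) (hzy : ¬ G.Adj z y) :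
    ∃ t, G.Adj z t ∧ ¬ G.Adj x t := by
  by_contra! hsub
  have : G.neighborFinset z ⊂ G.neighborFinset x := by
    refine (ssubset_iff_of_subset fun t ht => ?_).2 ⟨y, by simpa, by simpa⟩
    simpa using hsub t (by simpa using ht)
  exact absurd (card_lt_card this) (not_lt.2 h)

end SimpleGraph

open SimpleGraph in
theorem isSplit_of_not_nonempty_embedding {V : Type*} [Finite V] {G : SimpleGraph V}
    (h₁ : ¬ Nonempty ((cycleGraph 4)ᶜ ↪g G)) (h₂ : ¬ Nonempty (cycleGraph 4 ↪g G))
    (h₃ : ¬ Nonempty (cycleGraph 5 ↪g G)) : IsSplit G := by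
  classical
  have := Fintype.ofFinite V
  obtain ⟨K, hK, hmax, htwo, hdeg⟩ := G.exists_isClique_forall_exchange
  refine ⟨K, (K : Set V)ᶜ, Set.union_compl_self _, disjoint_compl_right, hK, ?_⟩
  suffices H : ∀ x ∉ K, ∀ y ∉ K, G.Adj x y → ¬ ∀ u ∈ K, ¬ G.Adj x u → ¬ G.Adj y u by
    intro x hx y hy hxy
    have hx' := H x hx y hy hxy
    have hy' := H y hy x hx hxy.symm
    push Not at hx' hy'
    obtain ⟨u, hu, hxu, hyu⟩ := hx'
    obtain ⟨v, hv, hyv, hxv⟩ := hy'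
    have huv : u ≠ v := by rintro rfl; exact hxu hxv
    exact h₂ (nonempty_cycleGraph_four_embedding hxy hyu (hK hu hv huv) hxv.symm hxu hyv
      (by rintro rfl; exact hx hu) (by rintro rfl; exact hy hv))
  intro x hx y hy hxy hsub
  obtain ⟨z, hz, hxz⟩ := hmax x hx
  have hyz := hsub z hz hxz
  have hxK (u : V) (hu : u ∈ K) (huz : u ≠ z) : G.Adj x u := by
    by_contra hxu
    exact h₁ (nonempty_compl_cycleGraph_four_embedding hxy (hK hu hz huz) hxu hxz
      (hsub u hu hxu) hyz)
  obtain ⟨w, hw, hwz, hyw⟩ := htwo x hx y hy hxy z hz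
  have hxw := hxK w hw hwz
  replace hyw : ¬ G.Adj y w := fun h => hyw ⟨hxw, h⟩
  obtain ⟨t, hzt, hxt⟩ := exists_adj_not_adj_of_degree_le (hdeg x hx z hz hxK) hxy
    (fun h => hyz h.symm)
  have htK : t ∉ K := fun ht => hxt (hxK t ht hzt.ne')
  by_cases hyt : G.Adj y t
  · by_cases htw : G.Adj t w
    · exact h₂ (nonempty_cycleGraph_four_embedding hxy hyt htw hxw.symm hxt hyw
        (by rintro rfl; exact hxz hzt.symm) (by rintro rfl; exact hy hw))
    · exact h₃ (nonempty_cycleGraph_five_embedding hxy hyt hzt.symm (hK hz hw hwz.symm) hxw.symm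
        hxt hyz htw (fun h => hxz h.symm) (fun h => hyw h.symm))
  · exact h₁ (nonempty_compl_cycleGraph_four_embedding hxy hzt hxz hxt hyz hyt)

/-- **Foldes–Hammer characterization of split graphs.**  A finite simple graph is split
iff it contains no induced subgraph isomorphic to `2K₂` (the complement of the 4-cycle),
`C₄`, or `C₅`.  (Graph embeddings `↪g` are exactly induced-subgraph embeddings.) -/
theorem foldes_hammer {V : Type*} [Fintype V] (G : SimpleGraph V) :
    IsSplit G ↔
      (¬ Nonempty ((SimpleGraph.cycleGraph 4)ᶜ ↪g G) ∧
       ¬ Nonempty (SimpleGraph.cycleGraph 4 ↪g G) ∧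
       ¬ Nonempty (SimpleGraph.cycleGraph 5 ↪g G)) := by
  refine ⟨fun h => ⟨?_, ?_, ?_⟩, fun h => isSplit_of_not_nonempty_embedding h.1 h.2.1 h.2.2⟩
  · rintro ⟨f⟩
    exact not_isSplit_cycleGraph_four (by simpa using (h.comap f).compl)
  · rintro ⟨f⟩
    exact not_isSplit_cycleGraph_four (h.comap f)
  · rintro ⟨f⟩
    exact not_isSplit_cycleGraph_five (h.comap f)
end
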